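/- Invertibility of the rule ≤∀R: if D is a derivation of Ψ ⊢ A ≤ ∀β.B, then there is a derivation D' of Ψ, β ⊢ A ≤ B whose size (number of rule applications) is strictly smaller than the size of D. -/

import Mathlib

set_option autoImplicit true

namespace DK

/-- Types: 1 | α | A → B | ∀α. A  (type variables named by naturals) -/
inductive Ty : Type where
  | unit : Ty
  | var : ℕ → Ty
  | arr : Ty → Ty → Ty
  | all : ℕ → Ty → Ty

/-- Monotypes: types containing no quantifiers. -/
def Ty.mono : Ty → Prop
  | .unit => True
  | .var _ => True
  | .arr A B => A.mono ∧ B.mono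
  | .all _ _ => False

/-- Free type variables. -/
def Ty.fv : Ty → Finset ℕ
  | .unit => ∅
  | .var a => {a}
  | .arr A B => A.fv ∪ B.fv
  | .all a A => A.fv.erase a

/-- `A.subst τ a` is the substitution [τ/a]A. -/
def Ty.subst : Ty → Ty → ℕ → Ty
  | .unit, _, _ => .unit
  | .var b, τ, a => if b = a then τ else .var b
  | .arr A B, τ, a => .arr (A.subst τ a) (B.subst τ a)
  | .all b A, τ, a => .all b (if b = a then A else A.subst τ a)

/-- Declarative context entries: type variables α and term variable typings x : A. -/
inductive Decl : Type where
  | tvar : ℕ → Decl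
  | var : ℕ → Ty → Decl

/-- Declarative contexts; the most recent declaration is the head
    (so "Ψ, α" is `Decl.tvar α :: Ψ`). -/
abbrev Ctx := List Decl

/-- Well-formedness Ψ ⊢ A : every free type variable of A is declared in Ψ. -/
def WfTy (Ψ : Ctx) (A : Ty) : Prop :=
  ∀ a ∈ A.fv, Decl.tvar a ∈ Ψ

/-- Declarative subtyping Ψ ⊢ A ≤ B. -/
inductive Sub : Ctx → Ty → Ty → Prop where
  | var : Decl.tvar a ∈ Ψ → Sub Ψ (.var a) (.var a)
  | unit : Sub Ψ .unit .unit
  | arr : Sub Ψ B₁ A₁ → Sub Ψ A₂ B₂ → Sub Ψ (.arr A₁ A₂) (.arr B₁ B₂)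
  | allL : (τ : Ty) → τ.mono → WfTy Ψ τ → Sub Ψ (A.subst τ a) B → Sub Ψ (.all a A) B
  | allR : Sub (Decl.tvar b :: Ψ) A B → Sub Ψ A (.all b B)

end DK

namespace DK

/-- Declarative subtyping derivations indexed by size (number of rule applications). -/
inductive SubN : ℕ → Ctx → Ty → Ty → Prop where
  | var : Decl.tvar a ∈ Ψ → SubN 1 Ψ (.var a) (.var a)
  | unit : SubN 1 Ψ .unit .unit
  | arr : SubN m Ψ B₁ A₁ → SubN n Ψ A₂ B₂ →
      SubN (m + n + 1) Ψ (.arr A₁ A₂) (.arr B₁ B₂)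
  | allL : (τ : Ty) → τ.mono → WfTy Ψ τ → SubN n Ψ (A.subst τ a) B →
      SubN (n + 1) Ψ (.all a A) B
  | allR : SubN n (Decl.tvar b :: Ψ) A B → SubN (n + 1) Ψ A (.all b B)

/-- Invertibility of ≤∀R: a derivation of Ψ ⊢ A ≤ ∀β.B yields a strictly smaller
    derivation of Ψ, β ⊢ A ≤ B. -/
theorem decl_invertibility (n : ℕ) (Ψ : Ctx) (A : Ty) (b : ℕ) (B : Ty)
    (h : SubN n Ψ A (.all b B)) :
    ∃ m, m < n ∧ SubN m (Decl.tvar b :: Ψ) A B := by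
  generalize hC : Ty.all b B = C at h
  induction h with
  | var _ => cases hC
  | unit => cases hC
  | arr _ _ _ _ => cases hC
  | allL τ hτ hwf _ ih =>
    obtain ⟨m, hm, hsub⟩ := ih hC
    exact ⟨m + 1, Nat.succ_lt_succ hm,
      .allL τ hτ (fun c hc => List.mem_cons_of_mem _ (hwf c hc)) hsub⟩
  | allR hsub _ =>
    cases hC
    exact ⟨_, Nat.lt_succ_self _, hsub⟩

end DK
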